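/- Let γ denote the standard Gaussian probability measure on ℝ, φ the standard normal density and Φ the standard normal CDF. Let m ≥ 2 and a, b : Fin m → ℝ with b strictly increasing, define breakpoints z_i = (a_i − a_{i+1})/(b_{i+1} − b_i) for 0 ≤ i ≤ m−2, and suppose the breakpoints are strictly increasing. Then ∫_ℝ max_i (a_i + b_i·z) dγ(z) = Σ_{j=0}^{m−1} [ a_j·(Φ(z_j) − Φ(z_{j−1})) − b_j·(φ(z_j) − φ(z_{j−1})) ], with the conventions z_{−1} = −∞, z_{m−1} = +∞, Φ(−∞) = 0, Φ(+∞) = 1, and φ(±∞) = 0. -/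

import Mathlib

open MeasureTheory ProbabilityTheory

/-- The standard Gaussian probability measure on ℝ (mean 0, variance 1). -/
noncomputable def stdGaussian : Measure ℝ := gaussianReal 0 1

/-- The standard normal density φ(z) = (2π)^{-1/2} exp(−z²/2). -/
noncomputable def stdNormalPDF (z : ℝ) : ℝ :=
  (Real.sqrt (2 * Real.pi))⁻¹ * Real.exp (-z ^ 2 / 2)

/-- The standard normal CDF Φ(z) = ∫_{−∞}^{z} φ(t) dt. -/
noncomputable def stdNormalCDF (z : ℝ) : ℝ := ∫ t in Set.Iic z, stdNormalPDF t


theorem pdf_eq (z : ℝ) : gaussianPDFReal 0 1 z = stdNormalPDF z := by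
  simp [gaussianPDFReal, stdNormalPDF]

theorem pdf_integrable : Integrable stdNormalPDF := by
  have h := integrable_gaussianPDFReal 0 1
  exact h.congr (Filter.Eventually.of_forall pdf_eq)

theorem pdf_total : ∫ z, stdNormalPDF z = 1 := by
  have h := integral_gaussianPDFReal_eq_one 0 (v := 1) one_ne_zero
  simpa only [pdf_eq] using h

theorem pdf_mul_integrable : Integrable (fun z => z * stdNormalPDF z) := by
  have h := (integrable_mul_exp_neg_mul_sq (b := 1 / 2) (by norm_num)).const_mul
    (Real.sqrt (2 * Real.pi))⁻¹
  refine h.congr (Filter.Eventually.of_forall fun z => ?_)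
  simp only [stdNormalPDF]
  rw [show -z ^ 2 / 2 = -(1 / 2) * z ^ 2 by ring]
  ring

theorem pdf_deriv (z : ℝ) : HasDerivAt (fun t => -stdNormalPDF t) (z * stdNormalPDF z) z := by
  unfold stdNormalPDF
  have h : HasDerivAt (fun t : ℝ => -t ^ 2 / 2) (-z) z := by
    have := ((hasDerivAt_id z).pow 2).neg.div_const 2
    refine (this.congr_deriv ?_)
    simp
    ring
  refine ((h.exp.const_mul (Real.sqrt (2 * Real.pi))⁻¹).neg).congr_deriv ?_
  ring

theorem pdf_tendsto : Filter.Tendsto (fun t => -stdNormalPDF t) Filter.atTop (nhds 0) := by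
  unfold stdNormalPDF
  have h : Filter.Tendsto (fun t : ℝ => -t ^ 2 / 2) Filter.atTop Filter.atBot := by
    have h1 : Filter.Tendsto (fun t : ℝ => t ^ 2 / 2) Filter.atTop Filter.atTop :=
      (Filter.tendsto_pow_atTop two_ne_zero).atTop_div_const (by norm_num)
    refine (Filter.tendsto_neg_atTop_atBot.comp h1).congr fun t => ?_
    simp only [Function.comp]
    ring
  have := ((Real.tendsto_exp_atBot.comp h).const_mul (Real.sqrt (2 * Real.pi))⁻¹).neg
  simpa using this

theorem int_Ioi_pdf (c : ℝ) : ∫ z in Set.Ioi c, stdNormalPDF z = 1 - stdNormalCDF c := by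
  have := intervalIntegral.integral_Iic_add_Ioi (b := c) pdf_integrable.integrableOn
    pdf_integrable.integrableOn
  rw [pdf_total] at this
  unfold stdNormalCDF
  linarith

theorem int_Ioi_mul (c : ℝ) : ∫ z in Set.Ioi c, z * stdNormalPDF z = stdNormalPDF c := by
  have := integral_Ioi_of_hasDerivAt_of_tendsto' (a := c) (fun x _ => pdf_deriv x)
    pdf_mul_integrable.integrableOn pdf_tendsto
  rw [this]; ring

theorem integrable_id_g : Integrable (fun z : ℝ => z) stdGaussian := by
  have h := (memLp_id_gaussianReal (μ := 0) (v := 1) 1).integrable le_rfl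
  exact h

instance : IsProbabilityMeasure stdGaussian := by unfold _root_.stdGaussian; infer_instance

theorem integrable_pos_g (c : ℝ) : Integrable (fun z : ℝ => max (z - c) 0) stdGaussian :=
  (integrable_id_g.sub (integrable_const c)).pos_part

theorem integral_pos_g (c : ℝ) :
    ∫ z, max (z - c) 0 ∂stdGaussian = stdNormalPDF c - c * (1 - stdNormalCDF c) := by
  unfold _root_.stdGaussian
  rw [integral_gaussianReal_eq_integral_smul one_ne_zero]
  have : ∀ z, gaussianPDFReal 0 1 z • max (z - c) 0 =
      (Set.Ioi c).indicator (fun z => z * stdNormalPDF z - c * stdNormalPDF z) z := by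
    intro z
    rw [pdf_eq]
    by_cases h : c < z
    · rw [Set.indicator_of_mem (by exact h), max_eq_left (by linarith), smul_eq_mul]; ring
    · rw [Set.indicator_of_notMem (by exact h), max_eq_right (by linarith)]; simp
  simp_rw [this]
  rw [integral_indicator measurableSet_Ioi, integral_sub pdf_mul_integrable.integrableOn
    (pdf_integrable.const_mul c).integrableOn, integral_const_mul, int_Ioi_mul, int_Ioi_pdf]

/-- The line sum representation. -/
theorem env_line (A B zb : ℕ → ℝ) (z : ℝ) (n : ℕ)
    (h : ∀ i < n, (B (i + 1) - B i) * zb i = A i - A (i + 1)) :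
    A n + B n * z = A 0 + B 0 * z + ∑ i ∈ Finset.range n, (B (i + 1) - B i) * (z - zb i) := by
  induction n with
  | zero => simp
  | succ n ih =>
    rw [Finset.sum_range_succ, ← add_assoc, ← ih fun i hi => h i (by omega)]
    have := h n (by omega)
    linear_combination this

theorem env_exists (A B zb : ℕ → ℝ) (z : ℝ) (n : ℕ)
    (h : ∀ i < n, (B (i + 1) - B i) * zb i = A i - A (i + 1))
    (hz : ∀ i, i + 1 < n → zb i < zb (i + 1)) :
    ∃ j ≤ n, A j + B j * z =
      A 0 + B 0 * z + ∑ i ∈ Finset.range n, (B (i + 1) - B i) * max (z - zb i) 0 := by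
  induction n with
  | zero => exact ⟨0, le_rfl, by simp⟩
  | succ n ih =>
    by_cases hc : z ≤ zb n
    · obtain ⟨j, hj, e⟩ := ih (fun i hi => h i (by omega)) (fun i hi => hz i (by omega))
      refine ⟨j, by omega, ?_⟩
      rw [Finset.sum_range_succ, e, max_eq_right (by linarith : z - zb n ≤ 0)]
      ring
    · have hle : ∀ k ≤ n, zb (n - k) ≤ zb n := by
        intro k
        induction k with
        | zero => intro _; simp
        | succ k ihk =>
          intro hk
          have h1 := hz (n - (k + 1)) (by omega)
          rw [show n - (k + 1) + 1 = n - k by omega] at h1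
          linarith [ihk (by omega)]
      refine ⟨n + 1, le_rfl, ?_⟩
      rw [env_line A B zb z (n + 1) h]
      congr 1
      refine Finset.sum_congr rfl fun i hi => ?_
      have hi' : i < n + 1 := Finset.mem_range.mp hi
      have h2 := hle (n - i) (by omega)
      rw [show n - (n - i) = i by omega] at h2
      rw [max_eq_left (by linarith)]

theorem final_sum (A B zb P F : ℕ → ℝ) (n : ℕ)
    (h : ∀ i < n, (B (i + 1) - B i) * zb i = A i - A (i + 1)) :
    A 0 + ∑ i ∈ Finset.range n, (B (i + 1) - B i) * (P i - zb i * (1 - F i)) =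
    ∑ j ∈ Finset.range (n + 1),
        (A j * ((if j + 1 < n + 1 then F j else 1) - (if j = 0 then 0 else F (j - 1))) -
          B j * ((if j + 1 < n + 1 then P j else 0) - (if j = 0 then 0 else P (j - 1)))) := by
  have key : ∀ n, ∑ j ∈ Finset.range (n + 1),
        (A j * ((if j + 1 < n + 1 then F j else 1) - (if j = 0 then 0 else F (j - 1))) -
          B j * ((if j + 1 < n + 1 then P j else 0) - (if j = 0 then 0 else P (j - 1)))) =
      ∑ j ∈ Finset.range n,
        (A j * (F j - (if j = 0 then 0 else F (j - 1))) -
          B j * (P j - (if j = 0 then 0 else P (j - 1)))) +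
        (A n * (1 - (if n = 0 then 0 else F (n - 1))) -
          B n * (0 - (if n = 0 then 0 else P (n - 1)))) := by
    intro n
    rw [Finset.sum_range_succ]
    congr 1
    · refine Finset.sum_congr rfl fun j hj => ?_
      have : j < n := Finset.mem_range.mp hj
      have h' : j + 1 < n + 1 := by omega
      simp only [if_pos h']
    · simp only [lt_irrefl, if_false]
  rw [key]
  induction n with
  | zero => simp
  | succ n ih =>
    rw [Finset.sum_range_succ, ← add_assoc, ih fun i hi => h i (by omega),
      Finset.sum_range_succ _ n]
    have := h n (by omega)
    simp only [Nat.add_eq_zero_iff, one_ne_zero, and_false, if_false, Nat.add_sub_cancel]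
    linear_combination (F n - 1) * this

/-- Gaussian expectation of the maximum of `m` affine functions with strictly
increasing slopes and strictly increasing breakpoints
`zb i = (a i − a (i+1))/(b (i+1) − b i)`:
∫ max_i (a_i + b_i z) dγ(z) = Σ_j [a_j (Φ(z_j) − Φ(z_{j−1})) − b_j (φ(z_j) − φ(z_{j−1}))]
with the conventions z_{−1} = −∞, z_{m−1} = +∞, Φ(−∞) = 0, Φ(+∞) = 1, φ(±∞) = 0. -/
theorem stmt_7 (m : ℕ) (hm : 2 ≤ m) (a b : Fin m → ℝ) (hb : StrictMono b)
    (zb : ℕ → ℝ)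
    (hzb : ∀ i : ℕ, (h : i + 1 < m) →
      zb i = (a ⟨i, by omega⟩ - a ⟨i + 1, h⟩) / (b ⟨i + 1, h⟩ - b ⟨i, by omega⟩))
    (hzmono : ∀ i : ℕ, i + 2 < m → zb i < zb (i + 1)) :
    (∫ z, Finset.univ.sup' ⟨⟨0, by omega⟩, Finset.mem_univ _⟩ (fun i => a i + b i * z)
        ∂stdGaussian) =
      ∑ j : Fin m,
        (a j * ((if (j : ℕ) + 1 < m then stdNormalCDF (zb (j : ℕ)) else 1) -
            (if (j : ℕ) = 0 then 0 else stdNormalCDF (zb ((j : ℕ) - 1)))) -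
          b j * ((if (j : ℕ) + 1 < m then stdNormalPDF (zb (j : ℕ)) else 0) -
            (if (j : ℕ) = 0 then 0 else stdNormalPDF (zb ((j : ℕ) - 1))))) := by
  obtain ⟨n, rfl⟩ : ∃ n, m = n + 1 := ⟨m - 1, by omega⟩
  set A : ℕ → ℝ := fun i => if h : i < n + 1 then a ⟨i, h⟩ else 0 with hA
  set B : ℕ → ℝ := fun i => if h : i < n + 1 then b ⟨i, h⟩ else 0 with hB
  have hAj : ∀ j : Fin (n + 1), a j = A j := fun j => by simp only [hA, dif_pos j.isLt]
  have hBj : ∀ j : Fin (n + 1), b j = B j := fun j => by simp only [hB, dif_pos j.isLt]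
  have hpos : ∀ i < n, 0 < B (i + 1) - B i := by
    intro i hi
    have : b ⟨i, by omega⟩ < b ⟨i + 1, by omega⟩ := hb (by simp [Fin.lt_def])
    rw [hBj, hBj] at this
    exact sub_pos.mpr this
  have hrel : ∀ i < n, (B (i + 1) - B i) * zb i = A i - A (i + 1) := by
    intro i hi
    have h1 := hzb i (by omega)
    rw [hAj, hAj, hBj, hBj] at h1
    simp only at h1
    rw [h1, mul_div_cancel₀ _ (hpos i hi).ne']
  have henv : ∀ z : ℝ, Finset.univ.sup' ⟨⟨0, by omega⟩, Finset.mem_univ _⟩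
      (fun i => a i + b i * z) =
      A 0 + B 0 * z + ∑ i ∈ Finset.range n, (B (i + 1) - B i) * max (z - zb i) 0 := by
    intro z
    apply le_antisymm
    · refine Finset.sup'_le _ _ fun j _ => ?_
      rw [hAj, hBj, env_line A B zb z j fun i hi => hrel i (by omega)]
      refine add_le_add le_rfl ?_
      calc _ ≤ ∑ i ∈ Finset.range (j : ℕ), (B (i + 1) - B i) * max (z - zb i) 0 := by
            refine Finset.sum_le_sum fun i hi => ?_
            have : i < (j : ℕ) := Finset.mem_range.mp hi
            exact mul_le_mul_of_nonneg_left (le_max_left _ _) (hpos i (by omega)).le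
        _ ≤ _ := by
            refine Finset.sum_le_sum_of_subset_of_nonneg
              (Finset.range_mono (by omega)) fun i hi _ => ?_
            exact mul_nonneg (hpos i (Finset.mem_range.mp hi)).le (le_max_right _ _)
    · obtain ⟨j, hj, e⟩ := env_exists A B zb z n hrel fun i hi => hzmono i (by omega)
      rw [← e]
      have := Finset.le_sup' (fun i => a i + b i * z)
        (Finset.mem_univ (⟨j, by omega⟩ : Fin (n + 1)))
      simp only [hAj, hBj] at this ⊢
      exact this
  simp_rw [henv]
  have hint : ∀ i ∈ Finset.range n,
      Integrable (fun z : ℝ => (B (i + 1) - B i) * max (z - zb i) 0) stdGaussian :=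
    fun i _ => (integrable_pos_g _).const_mul _
  have hid : ∫ z : ℝ, z ∂stdGaussian = 0 := integral_id_gaussianReal
  have hlin : Integrable (fun z : ℝ => A 0 + B 0 * z) _root_.stdGaussian :=
    (integrable_const _).add (integrable_id_g.const_mul _)
  rw [integral_add hlin
    (integrable_finsetSum _ hint), integral_add (integrable_const _)
    (integrable_id_g.const_mul _), integral_finset_sum _ hint, integral_const_mul, hid]
  simp_rw [integral_const_mul, integral_pos_g]
  have hfs := final_sum A B zb (fun i => stdNormalPDF (zb i)) (fun i => stdNormalCDF (zb i)) n hrel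
  simp only [hAj, hBj]
  rw [Fin.sum_univ_eq_sum_range (fun j => 
        (A j * ((if j + 1 < n + 1 then stdNormalCDF (zb j) else 1) -
            (if j = 0 then 0 else stdNormalCDF (zb (j - 1)))) -
          B j * ((if j + 1 < n + 1 then stdNormalPDF (zb j) else 0) -
            (if j = 0 then 0 else stdNormalPDF (zb (j - 1)))))) (n + 1), ← hfs]
  simp
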